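/- arXiv:2211.16468 — 2 statements merged into one kernel-verified Lean document; each statement's English description precedes it below -/
import Mathlib

section
/- Let G be a DAG and X, Y disjoint sets of vertices, and I ⊆ R ⊆ V with R disjoint from X ∪ Y. Every I-inclusion minimal FD set Z relative to (X,Y) satisfies Z ⊆ I ∪ An(Y), where An(Y) denotes the set of ancestors of Y. -/
/-- A directed graph on vertex type `V`, given by its edge relation. -/
structure CausalGraph (V : Type) where
  Edge : V → V → Prop

namespace CausalGraph

variable {V : Type}

/-- `G.Desc u v`: `v` is a descendant of `u`, i.e. `v` is reachable from `u`
along directed edges (every vertex is a descendant of itself). -/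
def Desc (G : CausalGraph V) (u v : V) : Prop := Relation.ReflTransGen G.Edge u v

/-- The set of descendants of a set of vertices. -/
def descendants (G : CausalGraph V) (A : Set V) : Set V := {v | ∃ a ∈ A, G.Desc a v}

/-- The set of ancestors of a set of vertices. -/
def ancestors (G : CausalGraph V) (A : Set V) : Set V := {u | ∃ a ∈ A, G.Desc u a}

/-- A graph is acyclic (a DAG) if it has no directed cycle. -/
def Acyclic (G : CausalGraph V) : Prop := ∀ v : V, ¬ Relation.TransGen G.Edge v v

/-- `G.underline S` : the graph `G` with every edge whose tail lies in `S` removed. -/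
def underline (G : CausalGraph V) (S : Set V) : CausalGraph V :=
  ⟨fun u v => G.Edge u v ∧ u ∉ S⟩

/-- A walk in `G`: a sequence of `len + 1` vertices, where consecutive vertices are
joined by an edge of `G` in either direction; `dir i = true` means the `i`-th edge is
traversed forwards (`vert i → vert (i+1)`), `dir i = false` means it is traversed
backwards (`vert i ← vert (i+1)`). -/
structure Walk (G : CausalGraph V) where
  len : ℕ
  vert : Fin (len + 1) → V
  dir : Fin len → Bool
  valid : ∀ i : Fin len,
    if dir i then G.Edge (vert i.castSucc) (vert i.succ)
    else G.Edge (vert i.succ) (vert i.castSucc)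

namespace Walk

variable {G : CausalGraph V}

/-- The first vertex of a walk. -/
def first (w : G.Walk) : V := w.vert 0

/-- The last vertex of a walk. -/
def last (w : G.Walk) : V := w.vert (Fin.last w.len)

/-- A path is a walk with pairwise distinct vertices. -/
def IsPath (w : G.Walk) : Prop := Function.Injective w.vert

/-- A way is a walk in which each vertex occurs at most twice. -/
def IsWay (w : G.Walk) : Prop :=
  ∀ x : V, Set.ncard {j : Fin (w.len + 1) | w.vert j = x} ≤ 2

/-- A directed (causal) walk: every edge is traversed forwards. -/
def IsDirected (w : G.Walk) : Prop := ∀ i : Fin w.len, w.dir i = true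

/-- A back-door walk: the first edge points into the first vertex. -/
def IsBD (w : G.Walk) : Prop := ∃ h : 0 < w.len, w.dir ⟨0, h⟩ = false

/-- The occurrence at (interior) position `j` is a collider: both incident edges of the
walk point into `vert j`. -/
def ColliderAt (w : G.Walk) (j : Fin (w.len + 1)) : Prop :=
  ∃ (_ : 0 < (j : ℕ)) (h2 : (j : ℕ) < w.len),
    w.dir ⟨(j : ℕ) - 1, by omega⟩ = true ∧ w.dir ⟨(j : ℕ), h2⟩ = false

/-- The occurrence at (interior) position `j` is a non-collider. -/
def NonColliderAt (w : G.Walk) (j : Fin (w.len + 1)) : Prop :=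
  ∃ (_ : 0 < (j : ℕ)) (h2 : (j : ℕ) < w.len),
    (w.dir ⟨(j : ℕ) - 1, by omega⟩ = false ∨ w.dir ⟨(j : ℕ), h2⟩ = true)

/-- A path is open given `C` if every collider on it has a descendant in `C` and
every non-collider on it is not in `C`. -/
def PathOpen (w : G.Walk) (C : Set V) : Prop :=
  (∀ j, w.ColliderAt j → ∃ d ∈ C, G.Desc (w.vert j) d) ∧
  (∀ j, w.NonColliderAt j → w.vert j ∉ C)

/-- A way is open given `C` if every collider on it is in `C` and every non-collider
on it is not in `C`. -/
def WayOpen (w : G.Walk) (C : Set V) : Prop :=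
  (∀ j, w.ColliderAt j → w.vert j ∈ C) ∧
  (∀ j, w.NonColliderAt j → w.vert j ∉ C)

/-- The `i`-th edge of the walk points out of the vertex `x` (i.e. `x` is its tail). -/
def OutEdgeAt (w : G.Walk) (i : Fin w.len) (x : V) : Prop :=
  (w.dir i = true ∧ w.vert i.castSucc = x) ∨ (w.dir i = false ∧ w.vert i.succ = x)

end Walk

/-- d-separation: `G.dSep A B C` holds if no path from a vertex of `A` to a vertex of
`B` is open given `C`. -/
def dSep (G : CausalGraph V) (A B C : Set V) : Prop :=
  ¬ ∃ w : G.Walk, w.IsPath ∧ w.first ∈ A ∧ w.last ∈ B ∧ w.PathOpen C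

/-- `Z` intercepts every directed path from a vertex of `X` to a vertex of `Y`. -/
def Intercepts (G : CausalGraph V) (X Y Z : Set V) : Prop :=
  ∀ w : G.Walk, w.IsPath → w.IsDirected → w.first ∈ X → w.last ∈ Y →
    ∃ j, w.vert j ∈ Z

/-- The front-door criterion: `X`, `Y`, `Z` are pairwise disjoint, FD(1) `Z` intercepts
all directed paths from `X` to `Y`, FD(2) `(Z ⊥ X)` in `G_underline(X)`, and FD(3)
`(Z ⊥ Y | X)` in `G_underline(Z)`. -/
def IsFDSet (G : CausalGraph V) (X Y Z : Set V) : Prop :=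
  Disjoint X Y ∧ Disjoint X Z ∧ Disjoint Y Z ∧
  G.Intercepts X Y Z ∧
  (G.underline X).dSep Z X ∅ ∧
  (G.underline Z).dSep Z Y X

/-- `Z_(i)`: the vertices `z ∈ R` with `({z} ⊥ X)` in `G_underline(X)`. -/
def Zi (G : CausalGraph V) (X R : Set V) : Set V :=
  {z ∈ R | (G.underline X).dSep {z} X ∅}

/-- `Z_(ii)`: the vertices `z ∈ Z_(i)` for which there is `S ⊆ Z_(i)` with
`({z} ∪ S ⊥ Y | X)` in `G_underline({z} ∪ S)`. -/
def Zii (G : CausalGraph V) (X Y R : Set V) : Set V :=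
  {z ∈ G.Zi X R |
    ∃ S ⊆ G.Zi X R, (G.underline (insert z S)).dSep (insert z S) Y X}

/-- `Z` is an `I`-inclusion minimal FD set relative to `(X, Y)` with `I ⊆ Z ⊆ R`:
no proper subset `Z' ⊊ Z` with `I ⊆ Z'` is an FD set relative to `(X, Y)`. -/
def IsMinFDSet (G : CausalGraph V) (X Y I R Z : Set V) : Prop :=
  I ⊆ Z ∧ Z ⊆ R ∧ G.IsFDSet X Y Z ∧
  ∀ Z' : Set V, Z' ⊂ Z → I ⊆ Z' → ¬ G.IsFDSet X Y Z'

end CausalGraph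

namespace CausalGraph

variable {V : Type}

theorem Desc.of_underline {G : CausalGraph V} {S : Set V} {u v : V}
    (h : (G.underline S).Desc u v) : G.Desc u v :=
  Relation.ReflTransGen.mono (fun _ _ e => And.left e) _ _ h

theorem Acyclic.underline {G : CausalGraph V} (hG : G.Acyclic) (S : Set V) :
    (G.underline S).Acyclic :=
  fun v h => hG v (Relation.TransGen.mono (fun _ _ e => And.left e) _ _ h)

/-- Stopping a directed path at the first vertex of `X` avoids all edges with tail in `X`. -/
theorem Desc.exists_underline {G : CausalGraph V} {X : Set V} {u x : V}
    (h : G.Desc u x) (hx : x ∈ X) : ∃ x' ∈ X, (G.underline X).Desc u x' := by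
  induction h using Relation.ReflTransGen.head_induction_on with
  | refl => exact ⟨x, hx, .refl⟩
  | @head a c hac _ ih =>
    obtain ⟨x', hx', hc⟩ := ih
    by_cases ha : a ∈ X
    · exact ⟨a, ha, .refl⟩
    · exact ⟨x', hx', .head ⟨hac, ha⟩ hc⟩

/-- A directed path to `x` survives the removal of edges with tail in `S`, if no vertex of `S`
is an ancestor of `x`. -/
theorem Desc.underline {G : CausalGraph V} {S : Set V} {u x : V}
    (h : G.Desc u x) (hS : ∀ s ∈ S, ¬ G.Desc s x) : (G.underline S).Desc u x := by
  induction h using Relation.ReflTransGen.head_induction_on with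
  | refl => exact .refl
  | head hac hcx ih => exact .head ⟨hac, fun ha => hS _ ha (.head hac hcx)⟩ ih

theorem Desc.exists_seq {G : CausalGraph V} {u v : V} (h : G.Desc u v) :
    ∃ (n : ℕ) (f : ℕ → V), f 0 = u ∧ f n = v ∧ ∀ i < n, G.Edge (f i) (f (i + 1)) := by
  induction h using Relation.ReflTransGen.head_induction_on with
  | refl => exact ⟨0, fun _ => v, rfl, rfl, by simp⟩
  | @head a c hac _ ih =>
    obtain ⟨n, f, h0, hn, hf⟩ := ih
    refine ⟨n + 1, fun i => Nat.casesOn i a f, rfl, hn, fun i hi => ?_⟩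
    cases i with
    | zero => simpa [h0] using hac
    | succ i => exact hf i (by omega)

theorem Desc.exists_directed_path {G : CausalGraph V} (hG : G.Acyclic) {u v : V}
    (h : G.Desc u v) :
    ∃ w : G.Walk, w.IsPath ∧ w.IsDirected ∧ w.first = u ∧ w.last = v := by
  obtain ⟨n, f, h0, hn, hf⟩ := h.exists_seq
  have htrans : ∀ i j, i < j → j ≤ n → Relation.TransGen G.Edge (f i) (f j) := by
    intro i j hij
    induction j, hij using Nat.le_induction with
    | base => exact fun hj => .single (hf i (by omega))
    | succ j _ ih => exact fun hj => .tail (ih (by omega)) (hf j (by omega))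
  refine ⟨⟨n, fun i => f i, fun _ => true, fun i => by simpa using hf i i.2⟩, ?_,
    fun _ => rfl, h0, hn⟩
  intro i j hij
  have hij : f i = f j := hij
  rcases lt_trichotomy (i : ℕ) j with h | h | h
  · exact absurd (hij ▸ htrans i j h (Nat.le_of_lt_succ j.2)) (hG _)
  · exact Fin.ext h
  · exact absurd (hij ▸ htrans j i h (Nat.le_of_lt_succ i.2)) (hG _)

/-- If `Z` is marginally d-separated from `X` after removal of the edges out of `X`, then no
vertex of `Z` is an ancestor of `X`. -/
theorem not_desc_of_dSep_underline {G : CausalGraph V} (hG : G.Acyclic) {X Z : Set V}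
    (h : (G.underline X).dSep Z X ∅) {z x : V} (hz : z ∈ Z) (hx : x ∈ X) : ¬ G.Desc z x := by
  intro hzx
  obtain ⟨x', hx', hd⟩ := hzx.exists_underline hx
  obtain ⟨w, hp, hdir, hf, hl⟩ := hd.exists_directed_path (hG.underline X)
  refine h ⟨w, hp, hf ▸ hz, hl ▸ hx', ?_, fun _ _ => Set.notMem_empty _⟩
  rintro j ⟨_, h2, _, hc⟩
  simp [hdir ⟨j, h2⟩] at hc

theorem dSep.mono_left {G : CausalGraph V} {A A' B C : Set V} (h : G.dSep A B C)
    (hA : A' ⊆ A) : G.dSep A' B C :=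
  fun ⟨w, hp, hf, hl, ho⟩ => h ⟨w, hp, hA hf, hl, ho⟩

namespace Walk

variable {G : CausalGraph V}

/-- Following a walk along a forward edge, one moves along a directed path up to the end of the
walk or up to a collider. -/
theorem desc_last_or_collider (w : G.Walk) (i : Fin (w.len + 1))
    (hi : ∀ h : (i : ℕ) < w.len, w.dir ⟨i, h⟩ = true) :
    G.Desc (w.vert i) w.last ∨ ∃ k, w.ColliderAt k ∧ G.Desc (w.vert i) (w.vert k) := by
  induction i using Fin.reverseInduction with
  | last => exact .inl .refl
  | cast i ih =>
    have hdir : w.dir i = true := hi i.2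
    have hedge : G.Edge (w.vert i.castSucc) (w.vert i.succ) := by simpa [hdir] using w.valid i
    by_cases hs : ∀ h : (i.succ : ℕ) < w.len, w.dir ⟨i.succ, h⟩ = true
    · rcases ih hs with h | ⟨k, hk, h⟩
      · exact .inl (.head hedge h)
      · exact .inr ⟨k, hk, .head hedge h⟩
    · push Not at hs
      obtain ⟨h, hs⟩ := hs
      exact .inr ⟨i.succ, ⟨by simp, h, by simpa using hdir, by simpa using hs⟩, .single hedge⟩

/-- The part of a walk from position `j` on, seen in a graph that contains its edges. -/
def dropInto (w : G.Walk) (H : CausalGraph V) (j : Fin (w.len + 1))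
    (hH : ∀ i : Fin w.len, j ≤ i.castSucc →
      if w.dir i then H.Edge (w.vert i.castSucc) (w.vert i.succ)
      else H.Edge (w.vert i.succ) (w.vert i.castSucc)) : H.Walk where
  len := w.len - j
  vert i := w.vert ⟨j + i, by omega⟩
  dir i := w.dir ⟨j + i, by omega⟩
  valid i := hH ⟨j + i, by omega⟩ (by simp [Fin.le_def])

section dropInto

variable {H : CausalGraph V} {w : G.Walk} {j : Fin (w.len + 1)}
  {hH : ∀ i : Fin w.len, j ≤ i.castSucc →
    if w.dir i then H.Edge (w.vert i.castSucc) (w.vert i.succ)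
    else H.Edge (w.vert i.succ) (w.vert i.castSucc)}

theorem first_dropInto : (w.dropInto H j hH).first = w.vert j := rfl

theorem last_dropInto : (w.dropInto H j hH).last = w.last := by
  simp only [last, dropInto]
  congr 1
  ext
  simp
  omega

theorem IsPath.dropInto (hw : w.IsPath) : (w.dropInto H j hH).IsPath := by
  intro a b hab
  have := congrArg Fin.val (hw hab)
  ext
  simpa using this

theorem ColliderAt.of_dropInto {i : Fin ((w.dropInto H j hH).len + 1)}
    (h : (w.dropInto H j hH).ColliderAt i) :
    w.ColliderAt ⟨j + i, by have := i.2; simp only [Walk.dropInto] at this; omega⟩ := by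
  obtain ⟨h1, h2, h3, h4⟩ := h
  simp only [Walk.dropInto] at h2 h3 h4
  refine ⟨Nat.add_pos_right _ h1, Nat.add_lt_of_lt_sub' h2, ?_, h4⟩
  convert h3 using 3
  simp
  omega

theorem NonColliderAt.of_dropInto {i : Fin ((w.dropInto H j hH).len + 1)}
    (h : (w.dropInto H j hH).NonColliderAt i) :
    w.NonColliderAt ⟨j + i, by have := i.2; simp only [Walk.dropInto] at this; omega⟩ := by
  obtain ⟨h1, h2, h3⟩ := h
  simp only [Walk.dropInto] at h2 h3
  refine ⟨Nat.add_pos_right _ h1, Nat.add_lt_of_lt_sub' h2, h3.imp_left fun h3 => ?_⟩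
  convert h3 using 3
  simp
  omega

end dropInto

end Walk

/-- Discarding from an FD set vertices that are not ancestors of `Y` leaves an FD set. -/
theorem IsFDSet.inter {G : CausalGraph V} (hG : G.Acyclic) {X Y Z S : Set V}
    (hZ : G.IsFDSet X Y Z) (hS : G.ancestors Y ⊆ S) : G.IsFDSet X Y (Z ∩ S) := by
  obtain ⟨hXY, hXZ, hYZ, h1, h2, h3⟩ := hZ
  have hsub : Z ∩ S ⊆ Z := Set.inter_subset_left
  refine ⟨hXY, hXZ.mono_right hsub, hYZ.mono_right hsub, ?_, h2.mono_left hsub, ?_⟩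
  · intro w hp hd hf hl
    obtain ⟨j, hj⟩ := h1 w hp hd hf hl
    refine ⟨j, hj, hS ⟨w.last, hl, ?_⟩⟩
    rcases w.desc_last_or_collider j (fun _ => hd _) with h | ⟨k, ⟨_, h2, _, hc⟩, _⟩
    · exact h
    · simp [hd ⟨k, h2⟩] at hc
  · rintro ⟨w, hp, hf, hl, hcol, hnon⟩
    have hZX : ∀ z ∈ Z, ∀ x ∈ X, ¬ G.Desc z x :=
      fun z hz x hx => not_desc_of_dSep_underline hG h2 hz hx
    obtain ⟨j, hjZ, hjmax⟩ : ∃ j, w.vert j ∈ Z ∧ ∀ i, w.vert i ∈ Z → i ≤ j :=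
      (Set.toFinite {i | w.vert i ∈ Z}).exists_maximal ⟨0, hf.1⟩ |>.imp fun j hj =>
        ⟨hj.1, fun i hi => (le_total i j).elim id fun h => hj.2 hi h⟩
    -- A vertex of `Z` on the open path from which an edge leaves towards `Y` would be an
    -- ancestor of `X` or `Y`.
    have hout : ∀ h : (j : ℕ) < w.len, w.dir ⟨j, h⟩ ≠ true := by
      intro h hdir
      have hjS : w.vert j ∉ S := by
        have := w.valid ⟨j, h⟩
        simp only [hdir, if_true] at this
        exact fun hS => this.2 ⟨hjZ, hS⟩
      rcases w.desc_last_or_collider j (fun _ => hdir) with h | ⟨k, hk, h⟩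
      · exact hjS (hS ⟨_, hl, h.of_underline⟩)
      · obtain ⟨x, hx, hkx⟩ := hcol k hk
        exact hZX _ hjZ x hx (h.of_underline.trans hkx.of_underline)
    refine h3 ⟨w.dropInto (G.underline Z) j ?_, hp.dropInto, hjZ, ?_, ?_, ?_⟩
    · intro i hi
      have hv := w.valid i
      have hsucc : w.vert i.succ ∉ Z := fun h =>
        absurd ((hjmax _ h).trans hi) (by simp [Fin.le_def])
      by_cases hdir : w.dir i = true
      · simp only [hdir, if_true] at hv ⊢
        refine ⟨hv.1, fun h => ?_⟩
        obtain rfl := le_antisymm hi (hjmax _ h)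
        exact hout i.2 hdir
      · simp only [hdir] at hv ⊢
        exact ⟨hv.1, hsucc⟩
    · rwa [Walk.last_dropInto]
    · intro i hi
      obtain ⟨x, hx, hd⟩ := hcol _ hi.of_dropInto
      exact ⟨x, hx, hd.of_underline.underline fun z hz => hZX z hz x hx⟩
    · exact fun i hi => hnon _ hi.of_dropInto

end CausalGraph

/-- Every `I`-inclusion minimal FD set `Z` relative to `(X, Y)` satisfies
`Z ⊆ I ∪ An(Y)`. -/
theorem minimal_subset_ancestors
    {V : Type} [Fintype V] (G : CausalGraph V) (hG : G.Acyclic)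
    (X Y I R Z : Set V) (hXY : Disjoint X Y) (hIR : I ⊆ R) (hR : Disjoint R (X ∪ Y))
    (hmin : G.IsMinFDSet X Y I R Z) :
    Z ⊆ I ∪ G.ancestors Y := by
  obtain ⟨hI, -, hFD, hm⟩ := hmin
  intro z hz
  by_contra hzn
  refine hm (Z ∩ (I ∪ G.ancestors Y)) ⟨Set.inter_subset_left, fun h => hzn (h hz).2⟩
    (Set.subset_inter hI Set.subset_union_left) (hFD.inter hG Set.subset_union_right)
end

section
/- There exist a DAG G, two distinct vertices X and Y of G, and a three-element set Z of vertices disjoint from {X,Y} such that Z satisfies the FD criterion relative to ({X},{Y}), some singleton subset of Z satisfies the FD criterion relative to ({X},{Y}), but no two-element subset of Z satisfies the FD criterion relative to ({X},{Y}). In other words, the front-door criterion is non-monotone under taking subsets. -/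
namespace CausalGraph

variable {V : Type}

/-- A walk starting in a set closed under adjacency stays in it. -/
theorem Walk.vert_mem_of_closed {G : CausalGraph V} {S : Set V}
    (hS : ∀ u v, G.Edge u v → (u ∈ S ↔ v ∈ S)) (w : G.Walk) (h0 : w.first ∈ S)
    (j : Fin (w.len + 1)) : w.vert j ∈ S := by
  induction j using Fin.induction with
  | zero => exact h0
  | succ i ih =>
    have h := w.valid i
    split at h
    · exact (hS _ _ h).1 ih
    · exact (hS _ _ h).2 ih

/-- Sets separated by a union of connected components are d-separated. -/
theorem dSep_of_closed {G : CausalGraph V} {A B : Set V} (C S : Set V)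
    (hS : ∀ u v, G.Edge u v → (u ∈ S ↔ v ∈ S)) (hA : A ⊆ S) (hB : Disjoint S B) :
    G.dSep A B C := by
  rintro ⟨w, -, hf, hl, -⟩
  exact Set.disjoint_left.1 hB (w.vert_mem_of_closed hS (hA hf) _) hl

/-- `Z` intercepts all directed paths from `X` if it contains every child of `X`. -/
theorem intercepts_of_children_mem {G : CausalGraph V} {X Y Z : Set V} (hXY : Disjoint X Y)
    (hZ : ∀ u ∈ X, ∀ v, G.Edge u v → v ∈ Z) : G.Intercepts X Y Z := by
  rintro ⟨n, vert, dir, valid⟩ - hd hf hl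
  cases n with
  | zero => exact (Set.disjoint_left.1 hXY hf hl).elim
  | succ n =>
    have h := valid 0
    rw [if_pos (hd 0)] at h
    exact ⟨_, hZ _ hf _ h⟩

/-- The graph with paths `0 → 1 → 5`, `2 → 3 → 5` and `2 → 4 → 5`. -/
def threeChains : CausalGraph (Fin 6) :=
  ⟨fun u v => (u, v) ∈ [(0, 1), (1, 5), (2, 3), (2, 4), (3, 5), (4, 5)]⟩

instance : DecidableRel threeChains.Edge := fun u v => by
  unfold threeChains; infer_instance

theorem threeChains_acyclic : threeChains.Acyclic := by
  intro v hv
  have hlt : ∀ u v, threeChains.Edge u v → u < v := by decide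
  have key : ∀ u v, Relation.TransGen threeChains.Edge u v → u < v := by
    intro u v h
    induction h with
    | single h => exact hlt _ _ h
    | tail _ h ih => exact ih.trans (hlt _ _ h)
  exact lt_irrefl _ (key v v hv)

/-- In `threeChains`, FD(1) and FD(2) hold for every set that contains `1` but not `0` or `5`. -/
theorem threeChains_isFDSet {Z : Set (Fin 6)} (h0 : 0 ∉ Z) (h5 : 5 ∉ Z) (h1 : 1 ∈ Z)
    (hFD : (threeChains.underline Z).dSep Z {5} {0}) : threeChains.IsFDSet {0} {5} Z := by
  refine ⟨by simp, by simpa using h0, by simpa using h5, ?_, ?_, hFD⟩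
  · refine intercepts_of_children_mem (by simp) ?_
    rintro u rfl v huv
    have : ∀ v, threeChains.Edge 0 v → v = 1 := by decide
    exact this v huv ▸ h1
  · refine dSep_of_closed _ {0}ᶜ ?_ (by simpa using h0) disjoint_compl_left
    rintro u v ⟨huv, hu⟩
    have : ∀ u v, threeChains.Edge u v → v ≠ 0 := by decide
    simpa [this u v huv] using hu

/-- The directed path `0 → 1 → 5` forces every front-door set to contain `1`. -/
theorem threeChains_mem_of_isFDSet {Z : Set (Fin 6)} (h : threeChains.IsFDSet {0} {5} Z) :
    1 ∈ Z := by
  obtain ⟨-, h0, h5, h1, -⟩ := h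
  let w : threeChains.Walk := ⟨2, ![0, 1, 5], ![true, true], by decide⟩
  have hpath : w.IsPath := show Function.Injective (![0, 1, 5] : Fin 3 → Fin 6) by decide
  have hdir : w.IsDirected := show ∀ i, ![true, true] i = true by decide
  obtain ⟨j, hj⟩ := h1 w hpath hdir (Set.mem_singleton 0) (Set.mem_singleton 5)
  simp only [Set.disjoint_singleton_left] at h0 h5
  fin_cases j
  · exact absurd hj h0
  · exact hj
  · exact absurd hj h5

/-- The collider-free path `a ← 2 → b → 5` forbids front-door sets with exactly one of `3, 4`. -/
theorem threeChains_not_isFDSet {Z : Set (Fin 6)} {a b : Fin 6} (h2 : 2 ∉ Z) (ha : a ∈ Z)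
    (hb : b ∉ Z) (hab : (a, b) ∈ [((3 : Fin 6), (4 : Fin 6)), (4, 3)]) :
    ¬ threeChains.IsFDSet {0} {5} Z := by
  rintro ⟨-, -, -, -, -, h⟩
  have hE : ∀ a b : Fin 6, (a, b) ∈ [((3 : Fin 6), (4 : Fin 6)), (4, 3)] →
      threeChains.Edge 2 a ∧ threeChains.Edge 2 b ∧ threeChains.Edge b 5 ∧
      Function.Injective ![a, 2, b, 5] ∧ b ≠ 0 := by decide
  obtain ⟨e1, e2, e3, hinj, hb0⟩ := hE a b hab
  let w : (threeChains.underline Z).Walk := ⟨3, ![a, 2, b, 5], ![false, true, true], by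
    intro i
    fin_cases i
    exacts [⟨e1, h2⟩, ⟨e2, h2⟩, ⟨e3, hb⟩]⟩
  have hfirst : w.first = a := rfl
  refine h ⟨w, hinj, hfirst ▸ ha, Set.mem_singleton 5, ?_, ?_⟩
  · rintro j ⟨hj', hj, h3, h4⟩
    fin_cases j
    · exact absurd hj' (lt_irrefl 0)
    · exact Bool.noConfusion h3
    · exact Bool.noConfusion h4
    · exact absurd hj (lt_irrefl 3)
  · rintro j ⟨hj, hj', -⟩
    fin_cases j
    · exact absurd hj (lt_irrefl 0)
    · exact show (2 : Fin 6) ∉ ({0} : Set (Fin 6)) by simp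
    · exact hb0
    · exact absurd hj' (lt_irrefl 3)

end CausalGraph

open CausalGraph

/-- There is a DAG with distinct vertices `X`, `Y` and a three-element
set `Z` disjoint from `{X, Y}` such that `Z` satisfies the FD criterion relative to
`({X}, {Y})`, some singleton subset of `Z` does as well, but no two-element subset of
`Z` does: the front-door criterion is non-monotone. -/
theorem fd_criterion_nonmonotone :
    ∃ (V : Type) (_ : Fintype V) (G : CausalGraph V), G.Acyclic ∧
      ∃ X Y : V, X ≠ Y ∧
      ∃ Z : Set V, Z.ncard = 3 ∧ Disjoint Z {X, Y} ∧
        G.IsFDSet {X} {Y} Z ∧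
        (∃ z ∈ Z, G.IsFDSet {X} {Y} {z}) ∧
        (∀ Z' ⊆ Z, Z'.ncard = 2 → ¬ G.IsFDSet {X} {Y} Z') := by
  refine ⟨Fin 6, inferInstance, threeChains, threeChains_acyclic, 0, 5, by decide, {1, 3, 4},
    ?_, ?_, ?_, ⟨1, by simp, ?_⟩, ?_⟩
  · rw [Set.ncard_eq_toFinset_card']
    decide
  · simp
  · refine threeChains_isFDSet (by simp) (by simp) (by simp) ?_
    refine dSep_of_closed _ {5}ᶜ ?_ (by simp) disjoint_compl_left
    rintro u v ⟨huv, hu⟩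
    have : ∀ u v, threeChains.Edge u v → u ≠ 5 ∧ (v = 5 → u = 1 ∨ u = 3 ∨ u = 4) := by decide
    have := this u v huv
    simp only [Set.mem_insert_iff, Set.mem_singleton_iff, Set.mem_compl_iff] at hu ⊢
    tauto
  · refine threeChains_isFDSet (by simp) (by simp) (by simp) ?_
    refine dSep_of_closed _ {0, 1} ?_ (by simp) (by simp)
    rintro u v ⟨huv, hu⟩
    have : ∀ u v, threeChains.Edge u v → u ≠ 1 → (u = 0 ∨ u = 1 ↔ v = 0 ∨ v = 1) := by decide
    exact this u v huv hu
  · intro Z hZ hcard hFD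
    have h1 := threeChains_mem_of_isFDSet hFD
    have h2 : (2 : Fin 6) ∉ Z := fun h => by simpa using hZ h
    by_cases h3 : 3 ∈ Z <;> by_cases h4 : 4 ∈ Z
    · have : Z = {1, 3, 4} := hZ.antisymm (by simp [Set.insert_subset_iff, *])
      rw [this, Set.ncard_eq_toFinset_card'] at hcard
      revert hcard
      decide
    · exact threeChains_not_isFDSet h2 h3 h4 (by decide) hFD
    · exact threeChains_not_isFDSet h2 h4 h3 (by decide) hFD
    · have : Z ⊆ {1} := fun z hz => by
        rcases hZ hz with rfl | rfl | rfl <;> simp_all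
      have := Set.ncard_le_ncard this
      rw [Set.ncard_singleton] at this
      omega
end
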